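/- arXiv:0806.1774 — 2 statements merged into one kernel-verified Lean document; each statement's English description precedes it below -/
import Mathlib

section
/- Let λ be a partition and suppose m is minimal such that the ladder L_m(λ) is disconnected. Then λ has an addable node lying in the ladder L_m. -/
/-- `lam` represents a partition: the parts are `lam 1, lam 2, …`, weakly decreasing,
with finitely many nonzero parts.  (The value at index `0` is ignored.) -/
def IsPartition (lam : ℕ → ℕ) : Prop :=
  (∀ i, 1 ≤ i → lam (i + 1) ≤ lam i) ∧ ∃ N, ∀ i, N ≤ i → lam i = 0

/-- The Young diagram of `lam`: the nodes `(i,j)` with `i,j ≥ 1` and `j ≤ lam i`. -/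
def diagram (lam : ℕ → ℕ) : Set (ℕ × ℕ) :=
  {p | 1 ≤ p.1 ∧ 1 ≤ p.2 ∧ p.2 ≤ lam p.1}

/-- The `l`-th ladder `L_l(lam)` of `lam` is disconnected. -/
def LadderDisconnected (lam : ℕ → ℕ) (l : ℕ) : Prop :=
  ∃ a b c, 1 ≤ a ∧ a < b ∧ b < c ∧ c ≤ l ∧
    (a, l + 1 - a) ∈ diagram lam ∧ (b, l + 1 - b) ∉ diagram lam ∧
    (c, l + 1 - c) ∈ diagram lam

/-- The residue of the node `(i,j)`: `(j - i) mod 2`, an element of `{0, 1} ⊆ ℤ`. -/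
def res (i j : ℕ) : ℤ := ((j : ℤ) - (i : ℤ)) % 2

/-- `(i,j)` is an addable node of `lam`: it is not a node of `lam`, and adding it
gives the Young diagram of a partition. -/
def Addable (lam : ℕ → ℕ) (i j : ℕ) : Prop :=
  (i, j) ∉ diagram lam ∧
    ∃ mu : ℕ → ℕ, IsPartition mu ∧ diagram mu = diagram lam ∪ {(i, j)}

/-- `(i,j)` is a removable node of `lam`: it is a node of `lam`, and removing it
gives the Young diagram of a partition. -/
def Removable (lam : ℕ → ℕ) (i j : ℕ) : Prop :=
  (i, j) ∈ diagram lam ∧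
    ∃ mu : ℕ → ℕ, IsPartition mu ∧ diagram mu = diagram lam \ {(i, j)}

/-- `mu` is the partition `lam^{+x}` obtained from `lam` by adding all addable nodes
of residue `x`. -/
def AddAllOfRes (lam : ℕ → ℕ) (x : ℤ) (mu : ℕ → ℕ) : Prop :=
  IsPartition mu ∧
    diagram mu = diagram lam ∪ {p : ℕ × ℕ | Addable lam p.1 p.2 ∧ res p.1 p.2 = x}

/-- The first node to the right of row `b + 1` is addable when row `b` is strictly longer. -/
theorem addable_of_lt (lam : ℕ → ℕ) (hlam : IsPartition lam) (b : ℕ) (hb : 1 ≤ b)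
    (h : lam (b + 1) < lam b) : Addable lam (b + 1) (lam (b + 1) + 1) := by
  obtain ⟨hmono, N, hN⟩ := hlam
  refine ⟨by simp [diagram], Function.update lam (b + 1) (lam (b + 1) + 1),
    ⟨fun i hi => ?_, N + b + 2, fun i hi => ?_⟩, ?_⟩
  · have := hmono i hi
    simp only [Function.update_apply]
    grind
  · rw [Function.update_of_ne (by omega)]
    exact hN i (by omega)
  · ext ⟨i, j⟩
    simp only [diagram, Set.mem_union, Set.mem_ofPred_eq, Set.mem_singleton_iff, Prod.mk.injEq,
      Function.update_apply]
    grind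

/-- If `m` is minimal such that the `m`-th ladder of `lam` is disconnected, then
`lam` has an addable node lying in the ladder `L_m`. -/
theorem stmt10 (lam : ℕ → ℕ) (hlam : IsPartition lam) (m : ℕ)
    (hm : LadderDisconnected lam m)
    (hmin : ∀ k, k < m → ¬LadderDisconnected lam k) :
    ∃ i j, i + j = m + 1 ∧ Addable lam i j := by
  obtain ⟨a, b, c, ha, hab, hbc, hcm, hA, hB, hC⟩ := hm
  obtain ⟨b, rfl⟩ : ∃ b', b = b' + 1 := ⟨b - 1, by omega⟩
  obtain ⟨c, rfl⟩ : ∃ c', c = c' + 1 := ⟨c - 1, by omega⟩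
  obtain ⟨m, rfl⟩ : ∃ m', m = m' + 1 := ⟨m - 1, by omega⟩
  simp only [diagram, Set.mem_ofPred_eq] at hA hB hC
  have hconn : ∀ x, a ≤ x → x ≤ c → m + 1 - x ≤ lam x := by
    intro x hax hxc
    have hc := hlam.1 c (by omega)
    by_contra hx
    have hxa : x ≠ a := by rintro rfl; omega
    have hx_ne : x ≠ c := by rintro rfl; omega
    refine hmin m (by omega) ⟨a, x, c, ha, by omega, by omega, by omega, ?_, ?_, ?_⟩ <;>
      simp only [diagram, Set.mem_ofPred_eq] <;> omega
  have h₁ := hconn b (by omega) (by omega)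
  have h₂ := hconn (b + 1) (by omega) (by omega)
  exact ⟨b + 1, lam (b + 1) + 1, by omega,
    addable_of_lt lam hlam b (by omega) (by omega)⟩
end

section
/- Let l ≥ 0, let ν = (l, l−1, …, 2, 1) be the staircase partition, and let 0 ≤ w ≤ l + 1. For a partition λ obtained from ν by successively adding w dominoes, let λ^h_i be the number of horizontal dominoes in row i and λ^v_i the number of vertical dominoes in column i of the unique partition of [λ] \ [ν] into dominoes. Then: (a) λ^h = (λ^h_1, λ^h_2, …) and λ^v = (λ^v_1, λ^v_2, …) are partitions with |λ^h| + |λ^v| = w; (b) the assignment λ ↦ (λ^h, λ^v) is a bijection from the set of partitions obtainable from ν by adding w dominoes onto the set of pairs (σ, τ) of partitions with |σ| + |τ| = w; (c) λ is 2-regular if and only if λ^v = ∅, and λ is 2-restricted if and only if λ^h = ∅. -/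
/-- A domino: a pair of horizontally or vertically adjacent nodes. -/
def IsDomino (s : Set (ℕ × ℕ)) : Prop :=
  (∃ i j, 1 ≤ i ∧ 1 ≤ j ∧ s = {(i, j), (i, j + 1)}) ∨
  (∃ i j, 1 ≤ i ∧ 1 ≤ j ∧ s = {(i, j), (i + 1, j)})

/-- The partition `mu` is obtained from the partition `nu` by adding a domino. -/
def DominoStep (nu mu : ℕ → ℕ) : Prop :=
  IsPartition nu ∧ IsPartition mu ∧ diagram nu ⊆ diagram mu ∧
    IsDomino (diagram mu \ diagram nu)

/-- `lam` is obtained from `nu` by successively adding `w` dominoes, every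
intermediate stage being a partition. -/
def ObtainedBy (nu : ℕ → ℕ) (w : ℕ) (lam : ℕ → ℕ) : Prop :=
  ∃ f : ℕ → ℕ → ℕ, f 0 = nu ∧ f w = lam ∧
    ∀ j, j < w → DominoStep (f j) (f (j + 1))

/-- `P` is a partition of the skew diagram `[lam] \ [nu]` into dominoes. -/
def IsTiling (nu lam : ℕ → ℕ) (P : Set (Set (ℕ × ℕ))) : Prop :=
  (∀ d ∈ P, IsDomino d) ∧ P.PairwiseDisjoint id ∧
    ⋃₀ P = diagram lam \ diagram nu

/-- The number of horizontal dominoes of `P` lying in row `i`. -/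
noncomputable def HorizCount (P : Set (Set (ℕ × ℕ))) (i : ℕ) : ℕ :=
  {d ∈ P | ∃ j, 1 ≤ j ∧ d = {(i, j), (i, j + 1)}}.ncard

/-- The number of vertical dominoes of `P` lying in column `j`. -/
noncomputable def VertCount (P : Set (Set (ℕ × ℕ))) (j : ℕ) : ℕ :=
  {d ∈ P | ∃ i, 1 ≤ i ∧ d = {(i, j), (i + 1, j)}}.ncard

/-- The size `|σ| = σ 1 + σ 2 + ⋯` of a partition, as the number of nodes of its
Young diagram. -/
noncomputable def size (sigma : ℕ → ℕ) : ℕ := (diagram sigma).ncard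

/-- A partition is 2-regular if no two consecutive parts are equal and positive. -/
def TwoRegular (lam : ℕ → ℕ) : Prop :=
  ∀ i, 1 ≤ i → ¬(lam i = lam (i + 1) ∧ 0 < lam (i + 1))

/-- A partition is 2-restricted if no two consecutive parts differ by `2` or more. -/
def TwoRestricted (lam : ℕ → ℕ) : Prop :=
  ∀ i, 1 ≤ i → ¬(2 ≤ lam i - lam (i + 1))

/-- The diagram obtained from the staircase `(l, l-1, …, 1)` by appending `2 * sigma i` nodes to
row `i` and `2 * tau j` nodes to column `j`. -/
def inflate (l : ℕ) (sigma tau : ℕ → ℕ) : Set (ℕ × ℕ) :=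
  {p | 1 ≤ p.1 ∧ 1 ≤ p.2 ∧
    (p.1 + p.2 ≤ l + 1 + 2 * sigma p.1 ∨ p.1 + p.2 ≤ l + 1 + 2 * tau p.2)}

lemma mem_inflate {l : ℕ} {sigma tau : ℕ → ℕ} {i j : ℕ} :
    (i, j) ∈ inflate l sigma tau ↔
      1 ≤ i ∧ 1 ≤ j ∧ (i + j ≤ l + 1 + 2 * sigma i ∨ i + j ≤ l + 1 + 2 * tau j) :=
  Iff.rfl

lemma mem_diagram {lam : ℕ → ℕ} {i j : ℕ} :
    (i, j) ∈ diagram lam ↔ 1 ≤ i ∧ 1 ≤ j ∧ j ≤ lam i :=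
  Iff.rfl

lemma mem_diagram_staircase {l i j : ℕ} :
    (i, j) ∈ diagram (fun i => l + 1 - i) ↔ 1 ≤ i ∧ 1 ≤ j ∧ i + j ≤ l + 1 := by
  rw [mem_diagram]
  omega

lemma image_swap_inflate (l : ℕ) (sigma tau : ℕ → ℕ) :
    Prod.swap '' inflate l sigma tau = inflate l tau sigma := by
  ext ⟨i, j⟩
  rw [Set.image_swap_eq_preimage_swap]
  simp only [Set.mem_preimage, Prod.swap_prod_mk, mem_inflate]
  grind

lemma inflate_congr {l : ℕ} {sigma tau sigma' tau' : ℕ → ℕ}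
    (hs : ∀ i, 1 ≤ i → sigma i = sigma' i) (ht : ∀ i, 1 ≤ i → tau i = tau' i) :
    inflate l sigma tau = inflate l sigma' tau' := by
  ext ⟨i, j⟩
  simp only [mem_inflate]
  grind

lemma diagram_staircase_eq_inflate {l : ℕ} {sigma tau : ℕ → ℕ}
    (hs : ∀ i, 1 ≤ i → sigma i = 0) (ht : ∀ i, 1 ≤ i → tau i = 0) :
    diagram (fun i => l + 1 - i) = inflate l sigma tau := by
  ext ⟨i, j⟩
  rw [mem_diagram_staircase, mem_inflate]
  grind

lemma diagram_congr {lam mu : ℕ → ℕ} (h : ∀ i, 1 ≤ i → lam i = mu i) :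
    diagram lam = diagram mu := by
  ext ⟨i, j⟩
  simp only [mem_diagram]
  grind

lemma eq_of_diagram_eq {lam mu : ℕ → ℕ} (h : diagram lam = diagram mu) {i : ℕ} (hi : 1 ≤ i) :
    lam i = mu i := by
  have key : ∀ j, 1 ≤ j → (j ≤ lam i ↔ j ≤ mu i) := fun j hj => by
    have := Set.ext_iff.mp h (i, j)
    simpa [mem_diagram, hi, hj] using this
  have h1 := key (lam i)
  have h2 := key (mu i)
  omega

lemma isPartition_staircase (l : ℕ) : IsPartition fun i => l + 1 - i :=
  ⟨fun i _ => Nat.sub_le_sub_left (Nat.le_succ i) _, l + 1, fun _ hi => Nat.sub_eq_zero_of_le hi⟩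

namespace IsPartition

variable {sigma : ℕ → ℕ}

lemma congr {mu : ℕ → ℕ} (h : IsPartition sigma) (hmu : ∀ i, 1 ≤ i → sigma i = mu i) :
    IsPartition mu := by
  obtain ⟨ha, N, hN⟩ := h
  refine ⟨fun i hi => ?_, N + 1, fun i hi => ?_⟩
  · rw [← hmu i hi, ← hmu (i + 1) (by omega)]
    exact ha i hi
  · rw [← hmu i (by omega)]
    exact hN i (by omega)

lemma le_of_le (h : IsPartition sigma) {i k : ℕ} (hi : 1 ≤ i) (hik : i ≤ k) :
    sigma k ≤ sigma i := by
  induction k, hik using Nat.le_induction with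
  | base => exact le_rfl
  | succ k hk ih => exact (h.1 k (by omega)).trans ih

lemma finite_diagram (h : IsPartition sigma) : (diagram sigma).Finite := by
  obtain ⟨N, hN⟩ := h.2
  refine (Set.finite_Icc ((0, 0) : ℕ × ℕ) (N, sigma 1)).subset ?_
  rintro ⟨i, j⟩ hij
  rw [mem_diagram] at hij
  have h1 := h.le_of_le le_rfl hij.1
  have h2 : i ≤ N := by
    by_contra hlt
    have := hN i (by omega)
    omega
  simp only [Set.mem_Icc, Prod.mk_le_mk]
  omega

lemma le_size (h : IsPartition sigma) {i : ℕ} (hi : 0 < sigma i) : i ≤ size sigma := by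
  have hsub : (fun k => (k, 1)) '' Set.Icc 1 i ⊆ diagram sigma := by
    rintro _ ⟨k, hk, rfl⟩
    have := h.le_of_le hk.1 hk.2
    rw [mem_diagram]
    exact ⟨hk.1, le_rfl, by omega⟩
  have hle := Set.ncard_le_ncard hsub h.finite_diagram
  rw [Set.ncard_image_of_injective _ (fun a b hab => by simpa using hab),
    Set.ncard_eq_toFinset_card'] at hle
  simpa [size] using hle

lemma eq_zero_of_size_eq_zero (h : IsPartition sigma) (h0 : size sigma = 0) {i : ℕ}
    (hi : 1 ≤ i) : sigma i = 0 := by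
  by_contra hne
  have := h.le_size (Nat.pos_of_ne_zero hne)
  omega

lemma size_update (h : IsPartition sigma) {i : ℕ} (hi : 1 ≤ i) :
    size (Function.update sigma i (sigma i + 1)) = size sigma + 1 := by
  have : diagram (Function.update sigma i (sigma i + 1)) =
      insert (i, sigma i + 1) (diagram sigma) := by
    ext ⟨a, b⟩
    simp only [Set.mem_insert_iff, mem_diagram, Prod.mk.injEq, Function.update_apply]
    grind
  rw [size, this, Set.ncard_insert_of_notMem _ h.finite_diagram, size]
  rw [mem_diagram]
  omega

lemma update (h : IsPartition sigma) {i : ℕ} (hi : i = 1 ∨ sigma i < sigma (i - 1)) :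
    IsPartition (Function.update sigma i (sigma i + 1)) := by
  obtain ⟨ha, N, hN⟩ := h
  refine ⟨fun k hk => ?_, max N (i + 1), fun k hk => ?_⟩
  · have := ha k hk
    simp only [Function.update_apply]
    grind
  · have := hN k (by omega)
    simp only [Function.update_apply]
    grind

/-- Removing a corner from a nonempty partition. -/
lemma exists_update (h : IsPartition sigma) (hpos : 0 < size sigma) :
    ∃ rho i, 1 ≤ i ∧ IsPartition rho ∧ sigma = Function.update rho i (rho i + 1) := by
  obtain ⟨i, hi, hlt⟩ : ∃ i, 1 ≤ i ∧ sigma (i + 1) < sigma i := by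
    by_contra! hcon
    obtain ⟨N, hN⟩ := h.2
    have hzero : ∀ k, 1 ≤ k → sigma k = 0 := by
      intro k hk
      have hconst : ∀ m, sigma k ≤ sigma (k + m) := by
        intro m
        induction m with
        | zero => exact le_rfl
        | succ m ih => exact ih.trans (hcon (k + m) (by omega))
      have := hconst N
      rw [hN (k + N) (by omega)] at this
      omega
    have hempty : diagram sigma = ∅ := by
      ext ⟨a, b⟩
      simp only [mem_diagram, Set.mem_empty_iff_false, iff_false]
      intro hab
      have := hzero a hab.1
      omega
    rw [size, hempty, Set.ncard_empty] at hpos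
    omega
  refine ⟨Function.update sigma i (sigma i - 1), i, hi, ?_, ?_⟩
  · obtain ⟨ha, N, hN⟩ := h
    refine ⟨fun k hk => ?_, N, fun k hk => ?_⟩
    · have := ha k hk
      simp only [Function.update_apply]
      grind
    · have := hN k hk
      simp only [Function.update_apply]
      grind
  · rw [Function.update_self, Function.update_idem, Nat.sub_add_cancel (by omega),
      Function.update_eq_self]

end IsPartition

/-- Row `i` and column `j` are not both extended beyond the staircase. -/
lemma add_le_of_pos {sigma tau : ℕ → ℕ} (hs : IsPartition sigma) (ht : IsPartition tau)
    {i j : ℕ} (hi : 0 < sigma i) (hj : 0 < tau j) : i + j ≤ size sigma + size tau :=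
  add_le_add (hs.le_size hi) (ht.le_size hj)

lemma inflate_subset_update (l : ℕ) (sigma tau : ℕ → ℕ) (i : ℕ) :
    inflate l sigma tau ⊆ inflate l (Function.update sigma i (sigma i + 1)) tau := by
  rintro ⟨a, b⟩ hab
  simp only [mem_inflate, Function.update_apply] at hab ⊢
  grind

lemma inflate_update_diff {l : ℕ} {sigma tau : ℕ → ℕ} {i j : ℕ} (hi : 1 ≤ i) (hj : 1 ≤ j)
    (hij : i + j = l + 2 + 2 * sigma i) (ht : ∀ b, 0 < tau b → i + b ≤ l + 1) :
    inflate l (Function.update sigma i (sigma i + 1)) tau \ inflate l sigma tau =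
      {(i, j), (i, j + 1)} := by
  ext ⟨a, b⟩
  have htb : tau b = 0 ∨ i + b ≤ l + 1 := (Nat.eq_zero_or_pos _).imp_right (ht b)
  simp only [Set.mem_sdiff, mem_inflate, Function.update_apply, Set.mem_insert_iff,
    Set.mem_singleton_iff, Prod.mk.injEq]
  by_cases ha : a = i
  · subst ha
    simp only [if_true, true_and]
    constructor <;> intro h <;> omega
  · simp only [if_neg ha]
    omega

/-- A horizontal domino added to `inflate l sigma tau` extends `sigma`. -/
lemma eq_inflate_of_diff_eq_horizontal {l : ℕ} {sigma tau : ℕ → ℕ} {S : Set (ℕ × ℕ)} {i j : ℕ}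
    (hs : IsPartition sigma) (ht : IsPartition tau) (hw : size sigma + size tau ≤ l)
    (hrow : ∀ a b, 1 ≤ a → 1 ≤ b → (a, b + 1) ∈ S → (a, b) ∈ S)
    (hcol : ∀ a b, 1 ≤ a → 1 ≤ b → (a + 1, b) ∈ S → (a, b) ∈ S)
    (hsub : inflate l sigma tau ⊆ S) (hi : 1 ≤ i) (hj : 1 ≤ j)
    (hd : S \ inflate l sigma tau = {(i, j), (i, j + 1)}) :
    IsPartition (Function.update sigma i (sigma i + 1)) ∧
      S = inflate l (Function.update sigma i (sigma i + 1)) tau := by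
  have hmem : ∀ a b, (a, b) ∈ S → (a, b) ∈ inflate l sigma tau ∨ a = i ∧ (b = j ∨ b = j + 1) := by
    intro a b hab
    by_cases hin : (a, b) ∈ inflate l sigma tau
    · exact Or.inl hin
    · have : (a, b) ∈ S \ inflate l sigma tau := ⟨hab, hin⟩
      rw [hd] at this
      simp only [Set.mem_insert_iff, Set.mem_singleton_iff, Prod.mk.injEq] at this
      grind
  have h1 : (i, j) ∈ S \ inflate l sigma tau := by simp [hd]
  have h2 : (i, j + 1) ∈ S \ inflate l sigma tau := by simp [hd]
  have hout := h1.2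
  rw [mem_inflate] at hout
  have hup : i = 1 ∨ 2 ≤ i ∧ i + j ≤ l + 1 + 2 * sigma (i - 1) := by
    rcases hi.eq_or_lt with h | h
    · exact Or.inl h.symm
    · refine Or.inr ⟨h, ?_⟩
      have hS := hcol (i - 1) (j + 1) (by omega) (by omega)
        (by rw [Nat.sub_add_cancel hi]; exact h2.1)
      have hD := (hmem _ _ hS).resolve_right (by omega)
      rw [mem_inflate] at hD
      have := ht.1 j hj
      omega
  have hupdate : i = 1 ∨ sigma i < sigma (i - 1) := by omega
  have hisize : i ≤ size sigma + 1 := by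
    have := hs.le_size (i := i - 1)
    omega
  have hij : i + j = l + 2 + 2 * sigma i := by
    by_contra hne
    rcases hj.eq_or_lt with h | h
    · omega
    · have hS := hrow i (j - 1) hi (by omega) (by rw [Nat.sub_add_cancel hj]; exact h1.1)
      have hD := (hmem _ _ hS).resolve_right (by omega)
      rw [mem_inflate] at hD
      have := ht.le_size (i := j - 1)
      omega
  refine ⟨hs.update hupdate, ?_⟩
  have hdiff := inflate_update_diff hi hj hij (tau := tau) fun b hb => by
    have := ht.le_size hb
    omega
  rw [← Set.sdiff_union_of_subset hsub, hd, ← hdiff,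
    Set.sdiff_union_of_subset (inflate_subset_update l sigma tau i)]

lemma image_swap_pair (a b c d : ℕ) :
    Prod.swap '' ({(a, b), (c, d)} : Set (ℕ × ℕ)) = {(b, a), (d, c)} := by
  simp [Set.image_pair]

/-- A vertical domino added to `inflate l sigma tau` extends `tau`. -/
lemma eq_inflate_of_diff_eq_vertical {l : ℕ} {sigma tau : ℕ → ℕ} {S : Set (ℕ × ℕ)} {i j : ℕ}
    (hs : IsPartition sigma) (ht : IsPartition tau) (hw : size sigma + size tau ≤ l)
    (hrow : ∀ a b, 1 ≤ a → 1 ≤ b → (a, b + 1) ∈ S → (a, b) ∈ S)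
    (hcol : ∀ a b, 1 ≤ a → 1 ≤ b → (a + 1, b) ∈ S → (a, b) ∈ S)
    (hsub : inflate l sigma tau ⊆ S) (hi : 1 ≤ i) (hj : 1 ≤ j)
    (hd : S \ inflate l sigma tau = {(i, j), (i + 1, j)}) :
    IsPartition (Function.update tau j (tau j + 1)) ∧
      S = inflate l sigma (Function.update tau j (tau j + 1)) := by
  have hmem : ∀ a b, (a, b) ∈ Prod.swap '' S ↔ (b, a) ∈ S := fun a b => by
    rw [Set.image_swap_eq_preimage_swap]; rfl
  obtain ⟨h1, h2⟩ := eq_inflate_of_diff_eq_horizontal (l := l) (S := Prod.swap '' S) ht hs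
    (by omega)
    (fun a b ha hb h => (hmem _ _).2 (hcol b a hb ha ((hmem _ _).1 h)))
    (fun a b ha hb h => (hmem _ _).2 (hrow b a hb ha ((hmem _ _).1 h)))
    (by rw [← image_swap_inflate]; exact Set.image_mono hsub) hj hi
    (by rw [← image_swap_inflate, ← Set.image_sdiff Prod.swap_injective, hd, image_swap_pair])
  refine ⟨h1, ?_⟩
  rw [← image_swap_inflate] at h2
  exact Set.image_injective.2 Prod.swap_injective h2

/-- Every partition obtained from the staircase by adding `w ≤ l + 1` dominoes has a diagram of the
form `inflate l sigma tau`. -/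
lemma ObtainedBy.exists_inflate {l w : ℕ} (hw : w ≤ l + 1) {lam : ℕ → ℕ}
    (h : ObtainedBy (fun i => l + 1 - i) w lam) :
    ∃ sigma tau, IsPartition sigma ∧ IsPartition tau ∧ size sigma + size tau = w ∧
      diagram lam = inflate l sigma tau := by
  obtain ⟨f, h0, rfl, hstep⟩ := h
  induction w with
  | zero =>
    have hz : IsPartition fun _ => 0 := ⟨fun _ _ => le_rfl, 0, fun _ _ => rfl⟩
    refine ⟨fun _ => 0, fun _ => 0, hz, hz, ?_, ?_⟩
    · have : diagram (fun _ => 0) = ∅ := by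
        ext ⟨i, j⟩
        simp only [mem_diagram, Set.mem_empty_iff_false, iff_false]
        omega
      simp [size, this]
    · rw [h0]
      exact diagram_staircase_eq_inflate (fun _ _ => rfl) fun _ _ => rfl
  | succ w ih =>
    obtain ⟨sigma, tau, hs, ht, hsize, hdiag⟩ :=
      ih (by omega) fun j hj => hstep j (by omega)
    obtain ⟨-, hp, hsub, hdom⟩ := hstep w (by omega)
    rw [hdiag] at hsub hdom
    have hrow : ∀ a b, 1 ≤ a → 1 ≤ b → (a, b + 1) ∈ diagram (f (w + 1)) →
        (a, b) ∈ diagram (f (w + 1)) := fun a b ha hb h => by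
      rw [mem_diagram] at h ⊢
      omega
    have hcol : ∀ a b, 1 ≤ a → 1 ≤ b → (a + 1, b) ∈ diagram (f (w + 1)) →
        (a, b) ∈ diagram (f (w + 1)) := fun a b ha hb h => by
      rw [mem_diagram] at h ⊢
      have := hp.1 a ha
      omega
    rcases hdom with ⟨i, j, hi, hj, hd⟩ | ⟨i, j, hi, hj, hd⟩
    · obtain ⟨hs', heq⟩ :=
        eq_inflate_of_diff_eq_horizontal hs ht (by omega) hrow hcol hsub hi hj hd
      exact ⟨_, tau, hs', ht, by rw [hs.size_update hi]; omega, heq⟩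
    · obtain ⟨ht', heq⟩ :=
        eq_inflate_of_diff_eq_vertical hs ht (by omega) hrow hcol hsub hi hj hd
      exact ⟨sigma, _, hs, ht', by rw [ht.size_update hj]; omega, heq⟩

lemma exists_diagram_eq_inflate (l : ℕ) {sigma tau : ℕ → ℕ} (hs : IsPartition sigma)
    (ht : IsPartition tau) : ∃ lam, IsPartition lam ∧ diagram lam = inflate l sigma tau := by
  classical
  set B := l + 1 + 2 * sigma 1 + 2 * tau 1 with hB
  have hbound : ∀ i j, (i, j) ∈ inflate l sigma tau → i + j ≤ B := by
    intro i j h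
    rw [mem_inflate] at h
    have := hs.le_of_le le_rfl h.1
    have := ht.le_of_le le_rfl h.2.1
    omega
  have hrow : ∀ i j k, 1 ≤ j → j ≤ k → (i, k) ∈ inflate l sigma tau →
      (i, j) ∈ inflate l sigma tau := by
    intro i j k hj hjk h
    rw [mem_inflate] at h ⊢
    have := ht.le_of_le hj hjk
    omega
  have hcol : ∀ i j, 1 ≤ i → (i + 1, j) ∈ inflate l sigma tau → (i, j) ∈ inflate l sigma tau := by
    intro i j hi h
    rw [mem_inflate] at h ⊢
    have := hs.1 i hi
    omega
  have hkey : ∀ i j, 1 ≤ j → (j ≤ Nat.findGreatest (fun j => (i, j) ∈ inflate l sigma tau) B ↔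
      (i, j) ∈ inflate l sigma tau) := by
    intro i j hj
    constructor
    · intro h
      exact hrow i j _ hj h (Nat.findGreatest_of_ne_zero (P := fun j => (i, j) ∈ inflate l sigma tau)
        rfl (by omega))
    · intro h
      exact Nat.le_findGreatest (by have := hbound i j h; omega) h
  refine ⟨fun i => Nat.findGreatest (fun j => (i, j) ∈ inflate l sigma tau) B, ⟨?_, B, ?_⟩, ?_⟩
  · intro i hi
    by_contra! hlt
    have h1 := (hkey (i + 1) _ (by omega)).1 le_rfl
    have h2 := (hkey i _ (by omega)).2 (hcol _ _ hi h1)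
    omega
  · intro i hi
    by_contra hne
    have h1 := hbound _ _ ((hkey i _ (Nat.pos_of_ne_zero hne)).1 le_rfl)
    omega
  · ext ⟨i, j⟩
    rw [mem_diagram]
    constructor
    · exact fun h => (hkey i j h.2.1).1 h.2.2
    · exact fun h => ⟨h.1, h.2.1, (hkey i j h.2.1).2 h⟩

lemma ObtainedBy.succ {nu lam mu : ℕ → ℕ} {w : ℕ} (h : ObtainedBy nu w lam)
    (hstep : DominoStep lam mu) : ObtainedBy nu (w + 1) mu := by
  obtain ⟨f, h0, rfl, hf⟩ := h
  refine ⟨Function.update f (w + 1) mu, ?_, Function.update_self .., fun j hj => ?_⟩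
  · rw [Function.update_of_ne (by omega), h0]
  · rw [Function.update_of_ne (by omega)]
    rcases (Nat.lt_succ_iff_lt_or_eq.1 hj) with h | rfl
    · rw [Function.update_of_ne (by omega)]
      exact hf j h
    · rwa [Function.update_self]

lemma isDomino_inflate_update_diff {l : ℕ} {sigma tau : ℕ → ℕ} {i : ℕ} (hs : IsPartition sigma)
    (ht : IsPartition tau) (hw : size sigma + size tau ≤ l) (hi : 1 ≤ i)
    (hs' : IsPartition (Function.update sigma i (sigma i + 1))) :
    ∃ j, 1 ≤ j ∧ inflate l (Function.update sigma i (sigma i + 1)) tau \ inflate l sigma tau =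
      {(i, j), (i, j + 1)} := by
  have hle := hs'.le_size (i := i) (by simp)
  rw [hs.size_update hi] at hle
  refine ⟨l + 2 + 2 * sigma i - i, by omega,
    inflate_update_diff hi (by omega) (by omega) fun b hb => ?_⟩
  have := ht.le_size hb
  omega

lemma exists_obtainedBy {l w : ℕ} (hw : w ≤ l + 1) {sigma tau : ℕ → ℕ} (hs : IsPartition sigma)
    (ht : IsPartition tau) (hsize : size sigma + size tau = w) :
    ∃ lam, IsPartition lam ∧ ObtainedBy (fun i => l + 1 - i) w lam ∧
      diagram lam = inflate l sigma tau := by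
  induction w generalizing sigma tau with
  | zero =>
    exact ⟨_, isPartition_staircase l, ⟨fun _ => _, rfl, rfl, fun j hj => by omega⟩,
      diagram_staircase_eq_inflate (fun i => hs.eq_zero_of_size_eq_zero (by omega))
        fun i => ht.eq_zero_of_size_eq_zero (by omega)⟩
  | succ w ih =>
    obtain ⟨mu, hmu, hmud⟩ := exists_diagram_eq_inflate l hs ht
    rcases Nat.eq_zero_or_pos (size sigma) with h0 | hpos
    · obtain ⟨rho, j, hj, hr, rfl⟩ := ht.exists_update (by omega)
      rw [hr.size_update hj] at hsize
      obtain ⟨lam, hlam, hob, hlamd⟩ := ih (by omega) hs hr (by omega)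
      obtain ⟨i, hi, hd⟩ := isDomino_inflate_update_diff (l := l) hr hs (by omega) hj ht
      refine ⟨mu, hmu, hob.succ ⟨hlam, hmu, ?_, Or.inr ⟨i, j, hi, hj, ?_⟩⟩, hmud⟩
      · rw [hlamd, hmud, ← image_swap_inflate, ← image_swap_inflate l _ sigma]
        exact Set.image_mono (inflate_subset_update ..)
      · rw [hlamd, hmud, ← image_swap_inflate, ← image_swap_inflate l rho,
          ← Set.image_sdiff Prod.swap_injective, hd, image_swap_pair]
    · obtain ⟨rho, i, hi, hr, rfl⟩ := hs.exists_update hpos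
      rw [hr.size_update hi] at hsize
      obtain ⟨lam, hlam, hob, hlamd⟩ := ih (by omega) hr ht (by omega)
      obtain ⟨j, hj, hd⟩ := isDomino_inflate_update_diff (l := l) hr ht (by omega) hi hs
      refine ⟨mu, hmu, hob.succ ⟨hlam, hmu, ?_, Or.inl ⟨i, j, hi, hj, ?_⟩⟩, hmud⟩
      · rw [hlamd, hmud]
        exact inflate_subset_update ..
      · rw [hlamd, hmud, hd]

namespace IsTiling

variable {l : ℕ} {nu lam sigma tau : ℕ → ℕ} {P : Set (Set (ℕ × ℕ))}

lemma eq_of_mem (h : IsTiling nu lam P) {d e : Set (ℕ × ℕ)} (hd : d ∈ P) (he : e ∈ P)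
    {x : ℕ × ℕ} (hxd : x ∈ d) (hxe : x ∈ e) : d = e :=
  h.2.1.elim hd he (Set.not_disjoint_iff.2 ⟨x, hxd, hxe⟩)

lemma mem_of_mem (h : IsTiling nu lam P) {d : Set (ℕ × ℕ)} (hd : d ∈ P) {x : ℕ × ℕ}
    (hx : x ∈ d) : x ∈ diagram lam \ diagram nu :=
  h.2.2 ▸ Set.mem_sUnion_of_mem hx hd

lemma swap {nu' lam' : ℕ → ℕ} (h : IsTiling nu lam P)
    (hnu : Prod.swap '' diagram nu = diagram nu')
    (hlam : Prod.swap '' diagram lam = diagram lam') :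
    IsTiling nu' lam' (Set.image Prod.swap '' P) := by
  refine ⟨?_, ?_, ?_⟩
  · rintro _ ⟨d, hd, rfl⟩
    rcases h.1 d hd with ⟨i, j, hi, hj, rfl⟩ | ⟨i, j, hi, hj, rfl⟩
    · exact Or.inr ⟨j, i, hj, hi, image_swap_pair ..⟩
    · exact Or.inl ⟨j, i, hj, hi, image_swap_pair ..⟩
  · rintro _ ⟨d, hd, rfl⟩ _ ⟨e, he, rfl⟩ hne
    exact Set.disjoint_image_of_injective Prod.swap_injective
      (h.2.1 hd he fun hde => hne (by rw [hde]))
  · rw [← hnu, ← hlam, ← Set.image_sdiff Prod.swap_injective, ← h.2.2, Set.sUnion_eq_biUnion,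
      Set.sUnion_eq_biUnion, Set.image_iUnion₂, Set.biUnion_image]

lemma vertCount_eq (P : Set (Set (ℕ × ℕ))) (j : ℕ) :
    VertCount P j = HorizCount (Set.image Prod.swap '' P) j := by
  have hinj : Function.Injective (Set.image (Prod.swap : ℕ × ℕ → ℕ × ℕ)) :=
    Set.image_injective.2 Prod.swap_injective
  rw [VertCount, HorizCount, ← Set.ncard_image_of_injective _ hinj]
  congr 1
  ext d
  constructor
  · rintro ⟨e, ⟨he, i, hi, rfl⟩, rfl⟩
    exact ⟨⟨_, he, rfl⟩, i, hi, image_swap_pair ..⟩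
  · rintro ⟨⟨e, he, rfl⟩, i, hi, heq⟩
    exact ⟨e, ⟨he, i, hi, hinj (by rw [heq, image_swap_pair])⟩, rfl⟩

/-- The nodes appended to row `i` are covered by consecutive horizontal dominoes. -/
lemma horizontal_mem (h : IsTiling (fun i => l + 1 - i) lam P) (hs : IsPartition sigma)
    (ht : IsPartition tau) (hw : size sigma + size tau ≤ l + 1)
    (hlam : diagram lam = inflate l sigma tau) {i j k : ℕ} (hi : 1 ≤ i) (hj : 1 ≤ j)
    (hk : k < sigma i) (hij : i + j = l + 2 + 2 * k) :
    ({(i, j), (i, j + 1)} : Set (ℕ × ℕ)) ∈ P := by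
  induction hm : i + 2 * j using Nat.strong_induction_on generalizing i j k with
  | _ m ih =>
    subst hm
    have hdiff : ∀ {a b}, (a, b) ∈ diagram lam \ diagram (fun i => l + 1 - i) ↔
        (a, b) ∈ inflate l sigma tau ∧ l + 2 ≤ a + b := by
      intro a b
      rw [hlam, Set.mem_sdiff, mem_diagram_staircase, mem_inflate]
      omega
    have hcell : (i, j) ∈ diagram lam \ diagram (fun i => l + 1 - i) := by
      rw [hdiff, mem_inflate]
      omega
    have hisize := hs.le_size (i := i) (by omega)
    rw [← h.2.2] at hcell
    obtain ⟨d, hd, hmem⟩ := hcell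
    have hno : ∀ {a b k' : ℕ}, 1 ≤ a → 1 ≤ b → k' < sigma a → a + b = l + 2 + 2 * k' →
        a + 2 * b < i + 2 * j → (a, b + 1) ∈ d → d = {(a, b), (a, b + 1)} :=
      fun ha hb hk' hab hlt hin =>
        h.eq_of_mem hd (ih _ hlt ha hb hk' hab rfl) hin (by simp)
    rcases h.1 d hd with ⟨a, b, ha, hb, rfl⟩ | ⟨a, b, ha, hb, rfl⟩ <;>
      simp only [Set.mem_insert_iff, Set.mem_singleton_iff, Prod.mk.injEq] at hmem
    · rcases hmem with ⟨rfl, rfl⟩ | ⟨rfl, rfl⟩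
      · exact hd
      · exfalso
        have hc := hdiff.1 (h.mem_of_mem hd (x := (i, b)) (by simp))
        have := hno (a := i) (b := b - 1) (k' := k - 1) hi (by omega) (by omega) (by omega)
          (by omega) (by rw [Nat.sub_add_cancel hb]; simp)
        have hx : (i, b + 1) ∈ ({(i, b - 1), (i, b - 1 + 1)} : Set (ℕ × ℕ)) := by
          rw [← this]; simp
        simp only [Set.mem_insert_iff, Set.mem_singleton_iff, Prod.mk.injEq] at hx
        omega
    · rcases hmem with ⟨rfl, rfl⟩ | ⟨rfl, rfl⟩
      · exfalso
        have hc := hdiff.1 (h.mem_of_mem hd (x := (i + 1, j)) (by simp))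
        rw [mem_inflate] at hc
        have h1 := add_le_of_pos hs ht (i := i) (j := j)
        have h2 := hs.le_size (i := i + 1)
        have := hno (a := i + 1) (b := j - 1) (k' := k) (by omega) (by omega) (by omega)
          (by omega) (by omega) (by rw [Nat.sub_add_cancel hj]; simp)
        have hx : (i, j) ∈ ({(i + 1, j - 1), (i + 1, j - 1 + 1)} : Set (ℕ × ℕ)) := by
          rw [← this]; simp
        simp only [Set.mem_insert_iff, Set.mem_singleton_iff, Prod.mk.injEq] at hx
        omega
      · exfalso
        have hc := hdiff.1 (h.mem_of_mem hd (x := (a, j)) (by simp))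
        have h1 := hs.1 a ha
        have := hno (a := a) (b := j - 1) (k' := k - 1) ha (by omega) (by omega)
          (by omega) (by omega) (by rw [Nat.sub_add_cancel hj]; simp)
        have hx : (a + 1, j) ∈ ({(a, j - 1), (a, j - 1 + 1)} : Set (ℕ × ℕ)) := by
          rw [← this]; simp
        simp only [Set.mem_insert_iff, Set.mem_singleton_iff, Prod.mk.injEq] at hx
        omega

lemma swap_inflate (h : IsTiling (fun i => l + 1 - i) lam P) (hs : IsPartition sigma)
    (ht : IsPartition tau) (hlam : diagram lam = inflate l sigma tau) :
    ∃ lam', diagram lam' = inflate l tau sigma ∧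
      IsTiling (fun i => l + 1 - i) lam' (Set.image Prod.swap '' P) := by
  obtain ⟨lam', -, hlam'⟩ := exists_diagram_eq_inflate l ht hs
  refine ⟨lam', hlam', h.swap ?_ ?_⟩
  · rw [diagram_staircase_eq_inflate (sigma := fun _ => 0) (tau := fun _ => 0)
      (fun _ _ => rfl) fun _ _ => rfl, image_swap_inflate]
  · rw [hlam, hlam', image_swap_inflate]

/-- The nodes appended to column `j` are covered by consecutive vertical dominoes. -/
lemma vertical_mem (h : IsTiling (fun i => l + 1 - i) lam P) (hs : IsPartition sigma)
    (ht : IsPartition tau) (hw : size sigma + size tau ≤ l + 1)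
    (hlam : diagram lam = inflate l sigma tau) {i j k : ℕ} (hi : 1 ≤ i) (hj : 1 ≤ j)
    (hk : k < tau j) (hij : i + j = l + 2 + 2 * k) :
    ({(i, j), (i + 1, j)} : Set (ℕ × ℕ)) ∈ P := by
  obtain ⟨lam', hlam', h'⟩ := h.swap_inflate hs ht hlam
  obtain ⟨d, hd, heq⟩ := h'.horizontal_mem ht hs (by omega) hlam' hj hi hk (by omega)
  rw [← image_swap_pair] at heq
  rwa [← Set.image_injective.2 Prod.swap_injective heq]

lemma horizCount_eq (h : IsTiling (fun i => l + 1 - i) lam P) (hs : IsPartition sigma)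
    (ht : IsPartition tau) (hw : size sigma + size tau ≤ l + 1)
    (hlam : diagram lam = inflate l sigma tau) {i : ℕ} (hi : 1 ≤ i) :
    HorizCount P i = sigma i := by
  have hset : {d ∈ P | ∃ j, 1 ≤ j ∧ d = {(i, j), (i, j + 1)}} =
      (fun k => ({(i, l + 2 + 2 * k - i), (i, l + 2 + 2 * k - i + 1)} : Set (ℕ × ℕ))) ''
        Set.Iio (sigma i) := by
    ext d
    constructor
    · rintro ⟨hd, j, hj, rfl⟩
      have hc := h.mem_of_mem hd (x := (i, j)) (by simp)
      rw [hlam, Set.mem_sdiff, mem_diagram_staircase, mem_inflate] at hc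
      obtain ⟨k, hk⟩ : ∃ k, i + j = l + 2 + 2 * k ∨ i + j = l + 3 + 2 * k :=
        ⟨(i + j - (l + 2)) / 2, by omega⟩
      by_cases hsig : i + j ≤ l + 1 + 2 * sigma i
      · have := hs.le_size (i := i) (by omega)
        rcases hk with hk | hk
        · refine ⟨k, Set.mem_Iio.2 (by omega), ?_⟩
          simp only [show l + 2 + 2 * k - i = j by omega]
        · exfalso
          have hd' := h.horizontal_mem hs ht hw hlam (i := i) (j := j - 1) (k := k) hi (by omega)
            (by omega) (by omega)
          have heq := h.eq_of_mem hd hd' (x := (i, j)) (by simp)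
            (by rw [Nat.sub_add_cancel hj]; simp)
          have hx : (i, j + 1) ∈ ({(i, j - 1), (i, j - 1 + 1)} : Set (ℕ × ℕ)) := by
            rw [← heq]; simp
          simp only [Set.mem_insert_iff, Set.mem_singleton_iff, Prod.mk.injEq] at hx
          omega
      · exfalso
        have htau := (hc.1.2.2).resolve_left hsig
        have := ht.le_size (i := j) (by omega)
        rcases hk with hk | hk
        · have hd' := h.vertical_mem hs ht hw hlam (i := i) (j := j) (k := k) hi hj
            (by omega) hk
          have heq := h.eq_of_mem hd hd' (x := (i, j)) (by simp) (by simp)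
          have hx : (i, j + 1) ∈ ({(i, j), (i + 1, j)} : Set (ℕ × ℕ)) := by
            rw [← heq]; simp
          simp at hx
        · have hd' := h.vertical_mem hs ht hw hlam (i := i - 1) (j := j) (k := k) (by omega) hj
            (by omega) (by omega)
          have heq := h.eq_of_mem hd hd' (x := (i, j)) (by simp)
            (by rw [Nat.sub_add_cancel hi]; simp)
          have hx : (i, j + 1) ∈ ({(i - 1, j), (i - 1 + 1, j)} : Set (ℕ × ℕ)) := by
            rw [← heq]; simp
          simp at hx
    · rintro ⟨k, hk, rfl⟩
      rw [Set.mem_Iio] at hk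
      have := hs.le_size (i := i) (by omega)
      exact ⟨h.horizontal_mem hs ht hw hlam (k := k) hi (by omega) hk (by omega), _,
        by omega, rfl⟩
  rw [HorizCount, hset, Set.InjOn.ncard_image, Set.ncard_eq_toFinset_card']
  · simp
  · intro k hk k' hk' heq
    rw [Set.mem_Iio] at hk hk'
    have := hs.le_size (i := i) (by omega)
    have h1 : (i, l + 2 + 2 * k - i) ∈
        ({(i, l + 2 + 2 * k' - i), (i, l + 2 + 2 * k' - i + 1)} : Set (ℕ × ℕ)) := by
      have hmem : (i, l + 2 + 2 * k - i) ∈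
        ({(i, l + 2 + 2 * k - i), (i, l + 2 + 2 * k - i + 1)} : Set (ℕ × ℕ)) := by simp
      exact (Set.ext_iff.1 heq _).1 hmem
    simp only [Set.mem_insert_iff, Set.mem_singleton_iff, Prod.mk.injEq] at h1
    omega

lemma vertCount_eq_of_inflate (h : IsTiling (fun i => l + 1 - i) lam P) (hs : IsPartition sigma)
    (ht : IsPartition tau) (hw : size sigma + size tau ≤ l + 1)
    (hlam : diagram lam = inflate l sigma tau) {j : ℕ} (hj : 1 ≤ j) :
    VertCount P j = tau j := by
  obtain ⟨lam', hlam', h'⟩ := h.swap_inflate hs ht hlam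
  rw [vertCount_eq, h'.horizCount_eq ht hs (by omega) hlam' hj]

end IsTiling

lemma exists_column_step_iff {l : ℕ} {sigma tau : ℕ → ℕ} (hs : IsPartition sigma)
    (ht : IsPartition tau) (hw : size sigma + size tau ≤ l + 1) :
    (∃ i j, 1 ≤ i ∧ 1 ≤ j ∧ (i + 1, j) ∈ inflate l sigma tau ∧ (i, j + 1) ∉ inflate l sigma tau) ↔
      ∃ j, 1 ≤ j ∧ tau j ≠ 0 := by
  constructor
  · rintro ⟨i, j, hi, hj, hin, hout⟩
    refine ⟨j, hj, fun h0 => ?_⟩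
    rw [mem_inflate] at hin hout
    have := hs.1 i hi
    omega
  · rintro ⟨j₀, hj₀, hne⟩
    obtain ⟨j, hj, hpos, hlast⟩ : ∃ j, 1 ≤ j ∧ 0 < tau j ∧ tau (j + 1) = 0 := by
      by_contra! hcon
      have hall : ∀ m, 0 < tau (j₀ + m) := by
        intro m
        induction m with
        | zero => exact Nat.pos_of_ne_zero hne
        | succ m ih => exact Nat.pos_of_ne_zero (hcon (j₀ + m) (by omega) ih)
      obtain ⟨N, hN⟩ := ht.2
      have := hall N
      rw [hN _ (by omega)] at this
      omega
    have h1 := ht.le_size hpos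
    have h2 := fun h => add_le_of_pos hs ht (i := l + 2 * tau j - j) h hpos
    refine ⟨l + 2 * tau j - j, j, by omega, hj, ?_, ?_⟩ <;> rw [mem_inflate] <;> omega

lemma twoRegular_iff_forall {lam : ℕ → ℕ} (h : IsPartition lam) :
    TwoRegular lam ↔
      ¬ ∃ i j, 1 ≤ i ∧ 1 ≤ j ∧ (i + 1, j) ∈ diagram lam ∧ (i, j + 1) ∉ diagram lam := by
  simp only [TwoRegular, mem_diagram]
  constructor
  · rintro hreg ⟨i, j, hi, hj, h1, h2⟩
    have := h.1 i hi
    exact hreg i hi (by omega)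
  · rintro hno i hi ⟨h1, h2⟩
    exact hno ⟨i, lam (i + 1), hi, by omega, by omega, by omega⟩

lemma twoRestricted_iff_forall {lam : ℕ → ℕ} :
    TwoRestricted lam ↔
      ¬ ∃ i j, 1 ≤ i ∧ 1 ≤ j ∧ (i, j + 1) ∈ diagram lam ∧ (i + 1, j) ∉ diagram lam := by
  simp only [TwoRestricted, mem_diagram]
  constructor
  · rintro hres ⟨i, j, hi, hj, h1, h2⟩
    exact hres i hi (by omega)
  · rintro hno i hi h1
    exact hno ⟨i, lam (i + 1) + 1, hi, by omega, by omega, by omega⟩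

lemma twoRegular_iff {l : ℕ} {lam sigma tau : ℕ → ℕ} (h : IsPartition lam)
    (hs : IsPartition sigma) (ht : IsPartition tau) (hw : size sigma + size tau ≤ l + 1)
    (hlam : diagram lam = inflate l sigma tau) :
    TwoRegular lam ↔ ∀ j, 1 ≤ j → tau j = 0 := by
  rw [twoRegular_iff_forall h, hlam, exists_column_step_iff hs ht hw]
  push Not
  rfl

lemma twoRestricted_iff {l : ℕ} {lam sigma tau : ℕ → ℕ}
    (hs : IsPartition sigma) (ht : IsPartition tau) (hw : size sigma + size tau ≤ l + 1)
    (hlam : diagram lam = inflate l sigma tau) :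
    TwoRestricted lam ↔ ∀ i, 1 ≤ i → sigma i = 0 := by
  have hswap := exists_column_step_iff ht hs (by rwa [add_comm])
  have : (∃ i j, 1 ≤ i ∧ 1 ≤ j ∧ (i, j + 1) ∈ inflate l sigma tau ∧
      (i + 1, j) ∉ inflate l sigma tau) ↔ ∃ i j, 1 ≤ i ∧ 1 ≤ j ∧
      (i + 1, j) ∈ inflate l tau sigma ∧ (i, j + 1) ∉ inflate l tau sigma := by
    rw [exists_comm, ← image_swap_inflate l sigma tau, Set.image_swap_eq_preimage_swap]
    simp only [Set.mem_preimage, Prod.swap_prod_mk]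
    grind
  rw [twoRestricted_iff_forall, hlam, this, hswap]
  push Not
  rfl

lemma ObtainedBy.isPartition {nu lam : ℕ → ℕ} {w : ℕ} (h : ObtainedBy nu w lam)
    (hnu : IsPartition nu) : IsPartition lam := by
  obtain ⟨f, rfl, rfl, hf⟩ := h
  cases w with
  | zero => exact hnu
  | succ w => exact (hf w (by omega)).2.1

/-- For the staircase `ν = (l, l-1, …, 1)` and `w ≤ l+1`:
(a) for each `lam` obtained from `ν` by adding `w` dominoes, and each domino tiling
`P` of `[lam] \ [ν]`, the row-counts `lam^h` of horizontal dominoes and the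
column-counts `lam^v` of vertical dominoes are partitions with `|lam^h| + |lam^v| = w`;
(c) `lam` is 2-regular iff `lam^v = ∅`, and 2-restricted iff `lam^h = ∅`;
(b) the assignment `lam ↦ (lam^h, lam^v)` is a bijection onto the pairs `(σ, τ)` of
partitions with `|σ| + |τ| = w`. -/
theorem stmt14 (l w : ℕ) (hw : w ≤ l + 1) :
    (∀ lam P, ObtainedBy (fun i => l + 1 - i) w lam →
      IsTiling (fun i => l + 1 - i) lam P →
      (IsPartition (fun i => HorizCount P i) ∧
        IsPartition (fun i => VertCount P i) ∧
        size (fun i => HorizCount P i) + size (fun i => VertCount P i) = w) ∧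
      (TwoRegular lam ↔ ∀ i, 1 ≤ i → VertCount P i = 0) ∧
      (TwoRestricted lam ↔ ∀ i, 1 ≤ i → HorizCount P i = 0)) ∧
    (∀ sigma tau : ℕ → ℕ, IsPartition sigma → IsPartition tau →
      size sigma + size tau = w →
      ∃ lam, ObtainedBy (fun i => l + 1 - i) w lam ∧
        ∀ P, IsTiling (fun i => l + 1 - i) lam P →
          ∀ i, 1 ≤ i → HorizCount P i = sigma i ∧ VertCount P i = tau i) ∧
    (∀ lam lam', ObtainedBy (fun i => l + 1 - i) w lam →
      ObtainedBy (fun i => l + 1 - i) w lam' →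
      (∃ P P', IsTiling (fun i => l + 1 - i) lam P ∧
        IsTiling (fun i => l + 1 - i) lam' P' ∧
        ∀ i, 1 ≤ i → HorizCount P i = HorizCount P' i ∧
          VertCount P i = VertCount P' i) →
      ∀ i, 1 ≤ i → lam i = lam' i) := by
  refine ⟨fun lam P hob hP => ?_, fun sigma tau hs ht hsize => ?_,
    fun lam lam' hob hob' hcounts i hi => ?_⟩
  · obtain ⟨sigma, tau, hs, ht, hsize, hlam⟩ := hob.exists_inflate hw
    have hH : ∀ i, 1 ≤ i → HorizCount P i = sigma i := fun i hi =>
      hP.horizCount_eq hs ht (by omega) hlam hi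
    have hV : ∀ i, 1 ≤ i → VertCount P i = tau i := fun i hi =>
      hP.vertCount_eq_of_inflate hs ht (by omega) hlam hi
    refine ⟨⟨hs.congr fun i hi => (hH i hi).symm, ht.congr fun i hi => (hV i hi).symm, ?_⟩, ?_, ?_⟩
    · rw [size, size, diagram_congr hH, diagram_congr hV]
      exact hsize
    · rw [twoRegular_iff (hob.isPartition (isPartition_staircase l)) hs ht (by omega) hlam]
      exact forall₂_congr fun i hi => by rw [hV i hi]
    · rw [twoRestricted_iff hs ht (by omega) hlam]
      exact forall₂_congr fun i hi => by rw [hH i hi]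
  · obtain ⟨lam, -, hob, hlam⟩ := exists_obtainedBy hw hs ht hsize
    exact ⟨lam, hob, fun P hP i hi => ⟨hP.horizCount_eq hs ht (by omega) hlam hi,
      hP.vertCount_eq_of_inflate hs ht (by omega) hlam hi⟩⟩
  · obtain ⟨P, P', hP, hP', heq⟩ := hcounts
    obtain ⟨sigma, tau, hs, ht, hsize, hlam⟩ := hob.exists_inflate hw
    obtain ⟨sigma', tau', hs', ht', hsize', hlam'⟩ := hob'.exists_inflate hw
    refine eq_of_diagram_eq ?_ hi
    rw [hlam, hlam']
    refine inflate_congr (fun k hk => ?_) fun k hk => ?_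
    · rw [← hP.horizCount_eq hs ht (by omega) hlam hk,
        ← hP'.horizCount_eq hs' ht' (by omega) hlam' hk, (heq k hk).1]
    · rw [← hP.vertCount_eq_of_inflate hs ht (by omega) hlam hk,
        ← hP'.vertCount_eq_of_inflate hs' ht' (by omega) hlam' hk, (heq k hk).2]
end
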